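/- A 2-form α on ℝ⁷ satisfies ⋆(α∧ω) = α if and only if α_{ij}ω_{ijk} = 0 for every k (summing over i,j). -/

import Mathlib

open scoped BigOperators

/-- The generalized Kronecker/Levi-Civita epsilon symbol on `Fin 7`. -/
noncomputable def eps (v : Fin 7 → Fin 7) : ℝ :=
  if h : Function.Bijective v then ((Equiv.Perm.sign (Equiv.ofBijective v h) : ℤ) : ℝ) else 0

/-- The basis monomial form `e_{I 0} ∧ ⋯ ∧ e_{I (p-1)}`, given by its components. -/
noncomputable def mono {p : ℕ} (I : Fin p → Fin 7) : (Fin p → Fin 7) → ℝ :=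
  fun v => Matrix.det (Matrix.of fun a b => if I a = v b then (1 : ℝ) else 0)

/-- A (componentwise) `p`-form: totally antisymmetric in its indices. -/
def IsForm {p : ℕ} (c : (Fin p → Fin 7) → ℝ) : Prop :=
  (∀ v : Fin p → Fin 7, ¬ Function.Injective v → c v = 0) ∧
  (∀ (v : Fin p → Fin 7) (σ : Equiv.Perm (Fin p)),
    c (v ∘ σ) = ((Equiv.Perm.sign σ : ℤ) : ℝ) * c v)

/-- Wedge product of forms, in components. -/
noncomputable def wedge {p q : ℕ} (a : (Fin p → Fin 7) → ℝ) (b : (Fin q → Fin 7) → ℝ) :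
    (Fin (p + q) → Fin 7) → ℝ := fun v =>
  (1 / ((Nat.factorial p : ℝ) * (Nat.factorial q : ℝ))) *
    ∑ σ : Equiv.Perm (Fin (p + q)),
      ((Equiv.Perm.sign σ : ℤ) : ℝ) *
        a (fun i => v (σ (Fin.castAdd q i))) * b (fun j => v (σ (Fin.natAdd p j)))

/-- The Hodge star operator (standard metric and orientation on ℝ⁷), in components. -/
noncomputable def hstar {p q : ℕ} (h : p + q = 7) (a : (Fin p → Fin 7) → ℝ) :
    (Fin q → Fin 7) → ℝ := fun w =>
  (1 / (Nat.factorial p : ℝ)) *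
    ∑ v : Fin p → Fin 7, a v * eps (fun i => Fin.append v w (Fin.cast h.symm i))

/-- The fundamental 3-form ω = e₁₂₄+e₂₃₅+e₃₄₆+e₄₅₇+e₅₆₁+e₆₇₂+e₇₁₃ (indices shifted to 0,…,6). -/
noncomputable def ω : (Fin 3 → Fin 7) → ℝ :=
  mono ![0, 1, 3] + mono ![1, 2, 4] + mono ![2, 3, 5] + mono ![3, 4, 6] +
    mono ![4, 5, 0] + mono ![5, 6, 1] + mono ![6, 0, 2]

/-- The 4-form Φ = −e₃₅₆₇−e₄₆₇₁−e₅₇₁₂−e₆₁₂₃−e₇₂₃₄−e₁₃₄₅−e₂₄₅₆ (indices shifted to 0,…,6). -/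
noncomputable def Φ : (Fin 4 → Fin 7) → ℝ :=
  -mono ![2, 4, 5, 6] - mono ![3, 5, 6, 0] - mono ![4, 6, 0, 1] - mono ![5, 0, 1, 2] -
    mono ![6, 1, 2, 3] - mono ![0, 2, 3, 4] - mono ![1, 3, 4, 5]

/-- Components ω_{ijk}. -/
noncomputable def ω3 (i j k : Fin 7) : ℝ := ω ![i, j, k]

/-- Components ω_{ijkl} = Φ(e_i,e_j,e_k,e_l). -/
noncomputable def ω4 (i j k l : Fin 7) : ℝ := Φ ![i, j, k, l]

/-- Kronecker delta. -/
def δ (i j : Fin 7) : ℝ := if i = j then 1 else 0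

/-- Components of a 2-form. -/
def c2 (a : (Fin 2 → Fin 7) → ℝ) (i j : Fin 7) : ℝ := a ![i, j]

/-- The operator α ↦ ⋆(α ∧ ω) on 2-forms. -/
noncomputable def Lω (a : (Fin 2 → Fin 7) → ℝ) : (Fin 2 → Fin 7) → ℝ :=
  hstar (p := 5) (q := 2) rfl (wedge a ω)

/-- The sign of `y - x`. -/
def pairSign (x y : Fin 7) : ℤ :=
  bif Nat.blt x y then 1 else bif Nat.blt y x then -1 else 0

/-- The product of the signs of `y - x` for `y` in a list. -/
def rowSign (x : Fin 7) : List (Fin 7) → ℤ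
  | [] => 1
  | y :: ys => pairSign x y * rowSign x ys

/-- The sign of a list of indices, as an integer product over its pairs of entries. -/
def listSign : List (Fin 7) → ℤ
  | [] => 1
  | x :: xs => rowSign x xs * listSign xs

theorem pairSign_of_lt {x y : Fin 7} (h : x < y) : pairSign x y = 1 := by
  have h1 : Nat.blt x y = true := by rw [Nat.blt_eq]; exact h
  simp [pairSign, h1]

theorem pairSign_of_gt {x y : Fin 7} (h : y < x) : pairSign x y = -1 := by
  have h' : ¬ (x : ℕ) < y := by omega
  have h1 : Nat.blt x y = false := by rw [← Bool.not_eq_true, Nat.blt_eq]; exact h'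
  have h2 : Nat.blt y x = true := by rw [Nat.blt_eq]; exact h
  simp [pairSign, h1, h2]

theorem pairSign_self (x : Fin 7) : pairSign x x = 0 := by
  have h1 : Nat.blt x x = false := by rw [← Bool.not_eq_true, Nat.blt_eq]; omega
  simp [pairSign, h1]

theorem listSign_ofFn (v : Fin 7 → Fin 7) :
    listSign (List.ofFn v) = ∏ i, ∏ j ∈ Finset.Ioi i, pairSign (v i) (v j) := by
  have h0 : Finset.Ioi (0 : Fin 7) = {1, 2, 3, 4, 5, 6} := rfl
  have h1 : Finset.Ioi (1 : Fin 7) = {2, 3, 4, 5, 6} := rfl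
  have h2 : Finset.Ioi (2 : Fin 7) = {3, 4, 5, 6} := rfl
  have h3 : Finset.Ioi (3 : Fin 7) = {4, 5, 6} := rfl
  have h4 : Finset.Ioi (4 : Fin 7) = {5, 6} := rfl
  have h5 : Finset.Ioi (5 : Fin 7) = {6} := rfl
  have h6 : Finset.Ioi (6 : Fin 7) = ∅ := rfl
  have hv : List.ofFn v = [v 0, v 1, v 2, v 3, v 4, v 5, v 6] := rfl
  rw [Fin.prod_univ_seven, h0, h1, h2, h3, h4, h5, h6, hv]
  simp [listSign, rowSign, mul_assoc]

theorem eps_eq_cast_listSign (v : Fin 7 → Fin 7) : eps v = (listSign (List.ofFn v) : ℝ) := by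
  rw [listSign_ofFn]
  unfold eps
  split_ifs with h
  · rw [Equiv.Perm.sign_eq_prod_prod_Ioi]
    push_cast
    refine Finset.prod_congr rfl fun i _ => Finset.prod_congr rfl fun j hj => ?_
    have hij : v i ≠ v j := h.1.ne (Finset.mem_Ioi.1 hj).ne
    simp only [Equiv.ofBijective_apply]
    split_ifs with hlt
    · simp [pairSign_of_lt hlt]
    · simp [pairSign_of_gt (lt_of_le_of_ne (not_lt.1 hlt) hij.symm)]
  · have hv : ¬ Function.Injective v := fun hi => h (Finite.injective_iff_bijective.1 hi)
    have : ∃ i j, i < j ∧ v i = v j := by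
      simp only [Function.Injective, not_forall] at hv
      obtain ⟨i, j, hij, hne⟩ := hv
      rcases lt_or_gt_of_ne hne with hlt | hlt
      · exact ⟨i, j, hlt, hij⟩
      · exact ⟨j, i, hlt, hij.symm⟩
    obtain ⟨i, j, hlt, hij⟩ := this
    rw [Finset.prod_eq_zero (Finset.mem_univ i), Int.cast_zero]
    exact Finset.prod_eq_zero (Finset.mem_Ioi.2 hlt) (by rw [hij, pairSign_self])

theorem eps_add_const (v : Fin 7 → Fin 7) (s : Fin 7) : eps (fun i => v i + s) = eps v := by
  have hs : Equiv.Perm.sign (Equiv.addRight s) = 1 := by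
    revert s
    decide
  have hv : (fun i => v i + s) = Equiv.addRight s ∘ v := rfl
  unfold eps
  by_cases h : Function.Bijective v
  · have h' : Function.Bijective fun i => v i + s := (Equiv.addRight s).bijective.comp h
    have : Equiv.ofBijective _ h' = Equiv.addRight s * Equiv.ofBijective v h := by
      ext i; rfl
    rw [dif_pos h, dif_pos h', this, Equiv.Perm.sign_mul, hs, one_mul]
  · rw [dif_neg h, dif_neg]
    rwa [hv, Function.Bijective.of_comp_iff' (Equiv.addRight s).bijective]

theorem eps_comp_perm (v : Fin 7 → Fin 7) (σ : Equiv.Perm (Fin 7)) :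
    eps (v ∘ σ) = ((Equiv.Perm.sign σ : ℤ) : ℝ) * eps v := by
  unfold eps
  by_cases h : Function.Bijective v
  · rw [dif_pos h, dif_pos (h.comp σ.bijective)]
    have : Equiv.ofBijective (v ∘ σ) (h.comp σ.bijective) = Equiv.ofBijective v h * σ := by
      ext i; rfl
    rw [this, Equiv.Perm.sign_mul]
    push_cast
    ring
  · rw [dif_neg h, dif_neg fun h' => h ((Function.Bijective.of_comp_iff v σ.bijective).1 h')]
    simp

/-- Permuting only the entries of `u` in the range of an embedding scales `eps u` by the sign. -/
theorem eps_permute_embedding {p : ℕ} (u u' : Fin 7 → Fin 7) (f : Fin p ↪ Fin 7)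
    (σ : Equiv.Perm (Fin p)) (h₁ : ∀ i, u' (f i) = u (f (σ i)))
    (h₂ : ∀ j ∉ Set.range f, u' j = u j) :
    eps u' = ((Equiv.Perm.sign σ : ℤ) : ℝ) * eps u := by
  have : u' = u ∘ σ.viaFintypeEmbedding f := by
    funext j
    by_cases hj : j ∈ Set.range f
    · obtain ⟨i, rfl⟩ := hj
      simp [h₁]
    · simp [h₂ j hj, Equiv.Perm.viaFintypeEmbedding_apply_notMem_range σ f hj]
  rw [this, eps_comp_perm, Equiv.Perm.viaFintypeEmbedding_sign]

theorem sign_mul_self_real {p : ℕ} (σ : Equiv.Perm (Fin p)) :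
    ((Equiv.Perm.sign σ : ℤ) : ℝ) * ((Equiv.Perm.sign σ : ℤ) : ℝ) = 1 := by
  exact_mod_cast Int.units_coe_mul_self (Equiv.Perm.sign σ)

theorem eps_append_comp_perm {p r : ℕ} (h : p + r = 7) (v : Fin p → Fin 7) (w : Fin r → Fin 7)
    (σ : Equiv.Perm (Fin p)) :
    eps (fun i => Fin.append (v ∘ σ) w (Fin.cast h.symm i)) =
      ((Equiv.Perm.sign σ : ℤ) : ℝ) * eps (fun i => Fin.append v w (Fin.cast h.symm i)) := by
  refine eps_permute_embedding _ _ ((Fin.castAddEmb r).trans (finCongr h).toEmbedding) σ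
    (fun i => ?_) fun j hj => ?_
  · simp
  · obtain ⟨k, rfl⟩ := (finCongr h).surjective j
    induction k using Fin.addCases with
    | left i => exact absurd ⟨i, rfl⟩ hj
    | right i => simp

theorem eps_append_append_comp_perm {p q r : ℕ} (h : p + q + r = 7) (x : Fin p → Fin 7)
    (y : Fin q → Fin 7) (w : Fin r → Fin 7) (σ : Equiv.Perm (Fin q)) :
    eps (fun i => Fin.append (Fin.append x (y ∘ σ)) w (Fin.cast h.symm i)) =
      ((Equiv.Perm.sign σ : ℤ) : ℝ) *
        eps (fun i => Fin.append (Fin.append x y) w (Fin.cast h.symm i)) := by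
  refine eps_permute_embedding _ _
    (((Fin.natAddEmb p).trans (Fin.castAddEmb r)).trans (finCongr h).toEmbedding) σ
    (fun i => ?_) fun j hj => ?_
  · simp
  · obtain ⟨k, rfl⟩ := (finCongr h).surjective j
    induction k using Fin.addCases with
    | left i =>
      induction i using Fin.addCases with
      | left i => simp
      | right i => exact absurd ⟨i, rfl⟩ hj
    | right i => simp

theorem hstar_wedge_apply {p q r : ℕ} (h : p + q + r = 7) (a : (Fin p → Fin 7) → ℝ)
    (b : (Fin q → Fin 7) → ℝ) (w : Fin r → Fin 7) :
    hstar h (wedge a b) w = (1 / ((Nat.factorial p : ℝ) * (Nat.factorial q : ℝ))) *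
      ∑ x : Fin p → Fin 7, ∑ y : Fin q → Fin 7, a x * b y *
        eps (fun i => Fin.append (Fin.append x y) w (Fin.cast h.symm i)) := by
  set E : (Fin (p + q) → Fin 7) → ℝ :=
    fun v => eps (fun i => Fin.append v w (Fin.cast h.symm i)) with hE
  set S : ℝ := ∑ v : Fin (p + q) → Fin 7,
    a (fun i => v (Fin.castAdd q i)) * b (fun j => v (Fin.natAdd p j)) * E v with hS
  have hsplit : S = ∑ x : Fin p → Fin 7, ∑ y : Fin q → Fin 7, a x * b y *
      E (Fin.append x y) := by
    rw [hS, ← (Fin.appendEquiv p q).sum_comp, Fintype.sum_prod_type]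
    simp [Fin.appendEquiv]
  have hσ (σ : Equiv.Perm (Fin (p + q))) : ∑ v : Fin (p + q) → Fin 7,
      ((Equiv.Perm.sign σ : ℤ) : ℝ) * a (fun i => v (σ (Fin.castAdd q i))) *
        b (fun j => v (σ (Fin.natAdd p j))) * E v = S := by
    rw [hS]
    conv_rhs => rw [← (Equiv.arrowCongr σ.symm (Equiv.refl (Fin 7))).sum_comp]
    refine Finset.sum_congr rfl fun v _ => ?_
    have hv : (Equiv.arrowCongr σ.symm (Equiv.refl (Fin 7))) v = v ∘ σ := by
      ext i; simp
    rw [hv, hE]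
    simp only [eps_append_comp_perm h v w σ]
    simp only [Function.comp_apply]
    ring
  have hsum : ∑ v : Fin (p + q) → Fin 7, wedge a b v * E v =
      (1 / ((Nat.factorial p : ℝ) * (Nat.factorial q : ℝ))) * ((Nat.factorial (p + q) : ℝ) * S) := by
    simp only [wedge, mul_assoc _ (∑ _, _), Finset.sum_mul, ← Finset.mul_sum]
    rw [Finset.sum_comm]
    simp [hσ, Fintype.card_perm]
  rw [← hsplit]
  unfold hstar
  rw [hsum]
  field_simp

theorem sum_mono_mul {p : ℕ} (I : Fin p → Fin 7) (f : (Fin p → Fin 7) → ℝ)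
    (hf : ∀ v (σ : Equiv.Perm (Fin p)), f (v ∘ σ) = ((Equiv.Perm.sign σ : ℤ) : ℝ) * f v) :
    ∑ v, mono I v * f v = (Nat.factorial p : ℝ) * f I := by
  have hmono (v : Fin p → Fin 7) : mono I v =
      ∑ σ : Equiv.Perm (Fin p), ((Equiv.Perm.sign σ : ℤ) : ℝ) * if I ∘ σ = v then 1 else 0 := by
    simp [mono, Matrix.det_apply', Fintype.prod_ite_zero, funext_iff]
  simp only [hmono, Finset.sum_mul]
  rw [Finset.sum_comm]
  simp [hf, ← mul_assoc, sign_mul_self_real, Fintype.card_perm]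

/-- The components of the fundamental 3-form, as integers. -/
def ωInt (i j k : Fin 7) : ℤ :=
  if (j - i, k - i) ∈ [((1, 3) : Fin 7 × Fin 7), (2, 6), (4, 5)] then 1
  else if (j - i, k - i) ∈ [((3, 1) : Fin 7 × Fin 7), (6, 2), (5, 4)] then -1 else 0

theorem ω_eq_sum_mono : ω = ∑ m : Fin 7, mono ![m, m + 1, m + 3] := by
  rw [Fin.sum_univ_seven]
  rfl

theorem ω3_eq_cast_ωInt (i j k : Fin 7) : ω3 i j k = (ωInt i j k : ℝ) := by
  have hdet : ∀ i j k : Fin 7, ∑ m : Fin 7,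
      ((if m = i then 1 else 0) * (if m + 1 = j then 1 else 0) * (if m + 3 = k then 1 else 0) -
      (if m = i then 1 else 0) * (if m + 1 = k then 1 else 0) * (if m + 3 = j then 1 else 0) -
      (if m = j then 1 else 0) * (if m + 1 = i then 1 else 0) * (if m + 3 = k then 1 else 0) +
      (if m = j then 1 else 0) * (if m + 1 = k then 1 else 0) * (if m + 3 = i then 1 else 0) +
      (if m = k then 1 else 0) * (if m + 1 = i then 1 else 0) * (if m + 3 = j then 1 else 0) -
      (if m = k then 1 else 0) * (if m + 1 = j then 1 else 0) * (if m + 3 = i then (1 : ℤ) else 0))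
      = ωInt i j k := by decide +kernel
  rw [← hdet, ω3, ω_eq_sum_mono, Finset.sum_apply]
  push_cast
  exact Finset.sum_congr rfl fun m _ => by simp only [mono, Matrix.det_fin_three]; rfl

theorem ωInt_add_const (i j k s : Fin 7) : ωInt (i + s) (j + s) (k + s) = ωInt i j k := by
  simp only [ωInt, add_sub_add_right_eq_sub]

theorem sum_listSign_eq (j k l : Fin 7) :
    ∑ m : Fin 7, listSign [0, j, m, m + 1, m + 3, k, l] =
      (if 0 = k ∧ j = l then 1 else 0) - (if 0 = l ∧ j = k then 1 else 0) -
        ∑ p, ωInt 0 j p * ωInt k l p := by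
  revert j k l
  decide +kernel

/-- The components of `⋆ω` in terms of those of `ω`. -/
theorem sum_eps_eq (i j k l : Fin 7) :
    ∑ m : Fin 7, eps ![i, j, m, m + 1, m + 3, k, l] =
      (if i = k ∧ j = l then 1 else 0) - (if i = l ∧ j = k then 1 else 0) -
        ∑ p, ω3 i j p * ω3 k l p := by
  obtain ⟨j, rfl⟩ := (Equiv.addRight i).surjective j
  obtain ⟨k, rfl⟩ := (Equiv.addRight i).surjective k
  obtain ⟨l, rfl⟩ := (Equiv.addRight i).surjective l
  have hv (m : Fin 7) : ![i, j + i, m + i, m + i + 1, m + i + 3, k + i, l + i] =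
      fun t => ![0, j, m, m + 1, m + 3, k, l] t + i := by
    ext t; fin_cases t <;> simp [add_right_comm]
  have hω (p : Fin 7) : ωInt i (j + i) (p + i) = ωInt 0 j p := by
    simpa using ωInt_add_const 0 j p i
  have h := congrArg (Int.cast : ℤ → ℝ) (sum_listSign_eq j k l)
  push_cast at h
  rw [← Equiv.sum_comp (Equiv.addRight i),
    ← Equiv.sum_comp (Equiv.addRight i) fun p => ω3 i _ p * ω3 _ _ p]
  simp only [Equiv.coe_addRight, hv, eps_add_const]
  simp only [ω3_eq_cast_ωInt, hω, ωInt_add_const, eps_eq_cast_listSign, right_eq_add, add_left_inj]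
  simpa [eq_comm] using h

theorem sum_ωInt_mul_ωInt (p q : Fin 7) :
    ∑ k, ∑ l, ωInt k l p * ωInt k l q = if p = q then 6 else 0 := by
  revert p q
  decide +kernel

theorem sum_ω3_mul_ω3 (p q : Fin 7) :
    ∑ k, ∑ l, ω3 k l p * ω3 k l q = if p = q then 6 else 0 := by
  simp only [ω3_eq_cast_ωInt]
  exact_mod_cast sum_ωInt_mul_ωInt p q

theorem IsForm.apply_swap {a : (Fin 2 → Fin 7) → ℝ} (ha : IsForm a) (i j : Fin 7) :
    a ![j, i] = -a ![i, j] := by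
  have h := ha.2 ![i, j] (Equiv.swap 0 1)
  have hv : ![i, j] ∘ Equiv.swap (0 : Fin 2) 1 = ![j, i] := by
    ext t; fin_cases t <;> simp
  simpa [hv] using h

theorem sum_fin_two_arrow (f : (Fin 2 → Fin 7) → ℝ) : ∑ x, f x = ∑ i, ∑ j, f ![i, j] := by
  rw [← (finTwoArrowEquiv (Fin 7)).symm.sum_comp, Fintype.sum_prod_type]
  rfl

/-- `⋆(α ∧ ω) = α - ½ X ⌟ ω` with `X_p = α_{ij} ω_{ijp}`. -/
theorem Lω_apply {a : (Fin 2 → Fin 7) → ℝ} (ha : IsForm a) (k l : Fin 7) :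
    Lω a ![k, l] = a ![k, l] -
      1 / 2 * ∑ p, (∑ i, ∑ j, c2 a i j * ω3 i j p) * ω3 k l p := by
  have hω (x : Fin 2 → Fin 7) : ∑ y : Fin 3 → Fin 7, ω y *
      eps (fun i => Fin.append (Fin.append x y) ![k, l] i) =
      6 * ∑ m : Fin 7, eps (Fin.append (Fin.append x ![m, m + 1, m + 3]) ![k, l]) := by
    simp only [ω_eq_sum_mono, Finset.sum_apply, Finset.sum_mul]
    rw [Finset.sum_comm, Finset.mul_sum]
    refine Finset.sum_congr rfl fun m _ => ?_
    rw [sum_mono_mul _ (fun y => eps (fun i => Fin.append (Fin.append x y) ![k, l] i))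
      fun y σ => eps_append_append_comp_perm (p := 2) (q := 3) (r := 2) rfl x y ![k, l] σ]
    norm_num [Nat.factorial]
  have hε (i j : Fin 7) :
      ∑ m : Fin 7, eps (Fin.append (Fin.append ![i, j] ![m, m + 1, m + 3]) ![k, l]) =
      (if i = k ∧ j = l then 1 else 0) - (if i = l ∧ j = k then 1 else 0) -
        ∑ p, ω3 i j p * ω3 k l p := by
    have hv (m : Fin 7) : Fin.append (Fin.append ![i, j] ![m, m + 1, m + 3]) ![k, l] =
        ![i, j, m, m + 1, m + 3, k, l] := by
      ext t; fin_cases t <;> rfl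
    simp only [hv, sum_eps_eq]
  have hL : Lω a ![k, l] = 1 / 2 * ∑ i, ∑ j, a ![i, j] *
      ((if i = k ∧ j = l then 1 else 0) - (if i = l ∧ j = k then 1 else 0) -
        ∑ p, ω3 i j p * ω3 k l p) := by
    refine (hstar_wedge_apply (p := 2) (q := 3) (r := 2) rfl a ω ![k, l]).trans ?_
    simp only [mul_assoc, ← Finset.mul_sum, Fin.cast_eq_self, hω]
    rw [sum_fin_two_arrow]
    simp only [hε, mul_left_comm _ (6 : ℝ), ← Finset.mul_sum]
    norm_num [Nat.factorial]
    ring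
  have h₁ (k l : Fin 7) :
      ∑ i, ∑ j, a ![i, j] * (if i = k ∧ j = l then (1 : ℝ) else 0) = a ![k, l] := by
    simp [ite_and]
  have h₂ : ∑ i, ∑ j, a ![i, j] * ∑ p, ω3 i j p * ω3 k l p =
      ∑ p, (∑ i, ∑ j, c2 a i j * ω3 i j p) * ω3 k l p := by
    simp only [Finset.sum_mul, Finset.mul_sum, c2, mul_assoc]
    rw [Finset.sum_comm_cycle]
  rw [hL]
  simp only [mul_sub, Finset.sum_sub_distrib, h₁, h₂, ha.apply_swap k l]
  ring

/-- a 2-form α satisfies ⋆(α∧ω) = α iff α_{ij}ω_{ijk} = 0 for all k. -/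
theorem lambda14_iff (a : (Fin 2 → Fin 7) → ℝ) (ha : IsForm a) :
    Lω a = a ↔ ∀ k : Fin 7, ∑ i : Fin 7, ∑ j : Fin 7, c2 a i j * ω3 i j k = 0 := by
  have hcontr (X : Fin 7 → ℝ) (q : Fin 7) :
      ∑ k, ∑ l, (∑ p, X p * ω3 k l p) * ω3 k l q = 6 * X q := by
    calc ∑ k, ∑ l, (∑ p, X p * ω3 k l p) * ω3 k l q
        = ∑ p, X p * ∑ k, ∑ l, ω3 k l p * ω3 k l q := by
          simp only [Finset.sum_mul, Finset.mul_sum, mul_assoc]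
          rw [Finset.sum_comm_cycle]
      _ = 6 * X q := by simp [sum_ω3_mul_ω3, mul_comm]
  constructor
  · intro h q
    have h0 (k l : Fin 7) : ∑ p, (∑ i, ∑ j, c2 a i j * ω3 i j p) * ω3 k l p = 0 := by
      have := Lω_apply ha k l
      rw [h] at this
      linarith
    have := hcontr (fun p => ∑ i, ∑ j, c2 a i j * ω3 i j p) q
    simp only [h0, zero_mul, Finset.sum_const_zero] at this
    linarith
  · intro h
    funext w
    have hw : w = ![w 0, w 1] := by ext t; fin_cases t <;> rfl
    rw [hw, Lω_apply ha]
    simp [h]
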